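/- Let (Γ, A) be an E-GCM graph with no odd asymmetries, i.e., whenever m_{ij} is odd one has a_{ij} = a_{ji}. Then |N(w)| = ℓ(w) for all w in the Coxeter group W, where N(w) is the set of positive roots of the geometric representation sent to negative roots by w. -/

import Mathlib

open Real

variable {n : ℕ}

/-- E-generalized Cartan matrix: diagonal entries 2, off-diagonal entries nonpositive,
`a_{ij} = 0 ↔ a_{ji} = 0`, and each off-diagonal product is `≥ 4` or of the form
`4cos²(π/k)` for an integer `k ≥ 2`. -/
def IsEGCM (A : Fin n → Fin n → ℝ) : Prop :=
  (∀ i, A i i = 2) ∧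
  (∀ i j, i ≠ j → A i j ≤ 0) ∧
  (∀ i j, A i j = 0 → A j i = 0) ∧
  (∀ i j, i ≠ j → A i j * A j i ≥ 4 ∨
    ∃ k : ℕ, 2 ≤ k ∧ A i j * A j i = 4 * (Real.cos (Real.pi / k)) ^ 2)

/-- The Coxeter exponent `m_{ij}` (with `0` encoding `∞`). -/
noncomputable def mval (A : Fin n → Fin n → ℝ) (i j : Fin n) : ℕ :=
  open scoped Classical in
  if h : ∃ k : ℕ, 2 ≤ k ∧ A i j * A j i = 4 * (Real.cos (Real.pi / k)) ^ 2
  then h.choose else 0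

/-- The generating "reflection" `S_i(v) = v - 2B(α_i, v)α_i` where `B(α_i, α_j) = a_{ij}/2`
and the simple roots `α_i` are the standard basis vectors of `Fin n → ℝ`. -/
noncomputable def S (A : Fin n → Fin n → ℝ) (i : Fin n) : Function.End (Fin n → ℝ) :=
  fun v => v - (∑ j, A i j * v j) • (Pi.single i (1 : ℝ) : Fin n → ℝ)

/-- The representing group `σ(W)`, as the monoid generated by the reflections `S_i`
(each `S_i` is an involution, so this is a group of transformations). -/
noncomputable def Wgrp (A : Fin n → Fin n → ℝ) : Submonoid (Function.End (Fin n → ℝ)) :=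
  Submonoid.closure (Set.range (S A))

/-- The simple root `α_i`. -/
noncomputable def simple (i : Fin n) : Fin n → ℝ := Pi.single i 1

/-- The root system `Φ = {w.α_i}`. -/
noncomputable def Phi (A : Fin n → Fin n → ℝ) : Set (Fin n → ℝ) :=
  {v | ∃ w ∈ Wgrp A, ∃ i, w (simple i) = v}

/-- Positive roots. -/
noncomputable def PhiPos (A : Fin n → Fin n → ℝ) : Set (Fin n → ℝ) :=
  {v | v ∈ Phi A ∧ ∀ j, 0 ≤ v j}

/-- Negative roots. -/
noncomputable def PhiNeg (A : Fin n → Fin n → ℝ) : Set (Fin n → ℝ) :=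
  {v | v ∈ Phi A ∧ ∀ j, v j ≤ 0}

/-- `𝔖(α)`: the positive roots which are real scalar multiples of `α`. -/
noncomputable def Sfrak (A : Fin n → Fin n → ℝ) (α : Fin n → ℝ) : Set (Fin n → ℝ) :=
  {β | β ∈ PhiPos A ∧ ∃ K : ℝ, β = K • α}

/-- `N(w)`: the positive roots sent to negative roots by `w`. -/
noncomputable def Nset (A : Fin n → Fin n → ℝ) (w : Function.End (Fin n → ℝ)) :
    Set (Fin n → ℝ) :=
  {α | α ∈ PhiPos A ∧ w α ∈ PhiNeg A}

/-- The Coxeter length of `w`: the least length of a word in the generators `S_i`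
representing `w`. -/
noncomputable def len (A : Fin n → Fin n → ℝ) (w : Function.End (Fin n → ℝ)) : ℕ :=
  sInf {p | ∃ l : List (Fin n), l.length = p ∧ (l.map (S A)).prod = w}

/-- `γ_i` and `γ_j` are odd neighbors: `m_{ij}` is odd (in particular finite). -/
def OddNbr (A : Fin n → Fin n → ℝ) (i j : Fin n) : Prop := i ≠ j ∧ Odd (mval A i j)

/-- The scalar `K_{ji} = -a_{ji}/(2cos(π/m_{ij}))`. -/
noncomputable def Kval (A : Fin n → Fin n → ℝ) (j i : Fin n) : ℝ :=
  -(A j i) / (2 * Real.cos (Real.pi / (mval A j i)))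

/-- The scalar `Π_𝒫` attached to an ON-path `𝒫`: the product of the `K`'s along its steps. -/
noncomputable def pathProd (A : Fin n → Fin n → ℝ) : List (Fin n) → ℝ
  | [] => 1
  | [_] => 1
  | i :: j :: t => Kval A j i * pathProd A (j :: t)

/-- An ON-path: consecutive nodes are odd neighbors. -/
def IsONPath (A : Fin n → Fin n → ℝ) (l : List (Fin n)) : Prop := l.Chain' (OddNbr A)

/-- An ON-cycle: an ON-path of nonzero length whose start and end nodes coincide. -/
def IsONCycle (A : Fin n → Fin n → ℝ) (l : List (Fin n)) : Prop :=
  IsONPath A l ∧ 2 ≤ l.length ∧ l.head? = l.getLast?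

/-- `(Γ, A)` is unital ON-cyclic: `Π_𝒞 = 1` for every ON-cycle `𝒞`. -/
def UnitalONCyclic (A : Fin n → Fin n → ℝ) : Prop :=
  ∀ l : List (Fin n), IsONCycle A l → pathProd A l = 1

section Reflections

variable {A : Fin n → Fin n → ℝ}

lemma simple_ne_zero (i : Fin n) : (simple i : Fin n → ℝ) ≠ 0 := by
  simp [simple]

lemma S_apply (i : Fin n) (v : Fin n → ℝ) : S A i v = v - (∑ j, A i j * v j) • simple i := rfl

lemma S_apply_of_ne {i j : Fin n} (h : j ≠ i) (v : Fin n → ℝ) : S A i v j = v j := by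
  simp [S_apply, simple, h]

lemma S_simple (i j : Fin n) : S A i (simple j) = simple j - A i j • simple i := by
  simp [S_apply, simple, Pi.single_apply]

lemma S_simple_self (hA : IsEGCM A) (i : Fin n) : S A i (simple i) = -simple i := by
  rw [S_simple, hA.1 i, two_smul]
  abel

/-- The reflection `S A i` as a linear map. -/
noncomputable def reflectionLin (A : Fin n → Fin n → ℝ) (i : Fin n) :
    (Fin n → ℝ) →ₗ[ℝ] (Fin n → ℝ) where
  toFun := S A i
  map_add' v w := by
    simp only [S_apply, Pi.add_apply, mul_add, Finset.sum_add_distrib, add_smul]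
    abel
  map_smul' c v := by
    simp only [S_apply, Pi.smul_apply, smul_eq_mul, RingHom.id_apply, smul_sub, smul_smul,
      Finset.mul_sum]
    congr 3
    exact funext fun j => by ring

lemma S_smul_add_smul (i : Fin n) (a b : ℝ) (v w : Fin n → ℝ) :
    S A i (a • v + b • w) = a • S A i v + b • S A i w := by
  have h := (reflectionLin A i).map_add (a • v) (b • w)
  rwa [map_smul, map_smul] at h

lemma S_S_apply (hA : IsEGCM A) (i : Fin n) (v : Fin n → ℝ) : S A i (S A i v) = v := by
  have h := (reflectionLin A i).map_sub v ((∑ j, A i j * v j) • simple i)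
  rw [map_smul] at h
  change S A i (v - (∑ j, A i j * v j) • simple i) =
    S A i v - (∑ j, A i j * v j) • S A i (simple i) at h
  rw [S_apply i v, h, S_simple_self hA, S_apply]
  simp

lemma S_mul_S (hA : IsEGCM A) (i : Fin n) : S A i * S A i = 1 :=
  funext (S_S_apply hA i)

lemma mul_S_mul_S (hA : IsEGCM A) (w : Function.End (Fin n → ℝ)) (i : Fin n) :
    w * S A i * S A i = w := by
  rw [mul_assoc, S_mul_S hA, mul_one]

lemma S_mem (i : Fin n) : S A i ∈ Wgrp A := Submonoid.subset_closure ⟨i, rfl⟩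

lemma exists_word {w : Function.End (Fin n → ℝ)} (hw : w ∈ Wgrp A) :
    ∃ l : List (Fin n), (l.map (S A)).prod = w := by
  induction hw using Submonoid.closure_induction with
  | mem x hx => obtain ⟨i, rfl⟩ := hx; exact ⟨[i], by simp⟩
  | one => exact ⟨[], rfl⟩
  | mul x y _ _ hx hy =>
    obtain ⟨l, rfl⟩ := hx
    obtain ⟨l', rfl⟩ := hy
    exact ⟨l ++ l', by simp⟩

/-- Every element of the group generated by the reflections is linear and injective. -/
lemma exists_linear (hA : IsEGCM A) {w : Function.End (Fin n → ℝ)} (hw : w ∈ Wgrp A) :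
    ∃ f : (Fin n → ℝ) →ₗ[ℝ] (Fin n → ℝ), Function.Injective f ∧ ∀ v, f v = w v := by
  induction hw using Submonoid.closure_induction with
  | mem x hx =>
    obtain ⟨i, rfl⟩ := hx
    exact ⟨reflectionLin A i, Function.LeftInverse.injective (S_S_apply hA i), fun _ => rfl⟩
  | one => exact ⟨LinearMap.id, Function.injective_id, fun _ => rfl⟩
  | mul x y _ _ hx hy =>
    obtain ⟨f, hf, hfx⟩ := hx
    obtain ⟨g, hg, hgy⟩ := hy
    refine ⟨f ∘ₗ g, hf.comp hg, fun v => ?_⟩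
    rw [LinearMap.comp_apply, hgy, hfx]
    rfl

lemma map_smul_add_smul (hA : IsEGCM A) {w : Function.End (Fin n → ℝ)} (hw : w ∈ Wgrp A)
    (a b : ℝ) (u v : Fin n → ℝ) : w (a • u + b • v) = a • w u + b • w v := by
  obtain ⟨f, -, hf⟩ := exists_linear hA hw
  simp [← hf]

lemma map_neg_of_mem (hA : IsEGCM A) {w : Function.End (Fin n → ℝ)} (hw : w ∈ Wgrp A)
    (v : Fin n → ℝ) : w (-v) = -w v := by
  obtain ⟨f, -, hf⟩ := exists_linear hA hw
  simp [← hf]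

lemma eq_zero_of_map_eq_zero (hA : IsEGCM A) {w : Function.End (Fin n → ℝ)} (hw : w ∈ Wgrp A)
    {v : Fin n → ℝ} (h : w v = 0) : v = 0 := by
  obtain ⟨f, hf, hfw⟩ := exists_linear hA hw
  exact hf (by rw [hfw, h, map_zero])

/-! ### Length -/

lemma len_prod_le (l : List (Fin n)) : len A (l.map (S A)).prod ≤ l.length :=
  Nat.sInf_le ⟨l, rfl, rfl⟩

lemma exists_reduced_word {w : Function.End (Fin n → ℝ)} (hw : w ∈ Wgrp A) :
    ∃ l : List (Fin n), l.length = len A w ∧ (l.map (S A)).prod = w := by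
  obtain ⟨l, hl⟩ := exists_word hw
  exact Nat.sInf_mem (s := {p | ∃ l : List (Fin n), l.length = p ∧ (l.map (S A)).prod = w})
    ⟨_, l, rfl, hl⟩

lemma len_mul_S_le {w : Function.End (Fin n → ℝ)} (hw : w ∈ Wgrp A) (i : Fin n) :
    len A (w * S A i) ≤ len A w + 1 := by
  obtain ⟨l, hl, rfl⟩ := exists_reduced_word hw
  simpa [← hl] using len_prod_le (A := A) (l ++ [i])

lemma len_one : len A 1 = 0 := Nat.le_zero.1 (len_prod_le [])

/-- An element other than `1` has a right descent. -/
lemma exists_right_descent (hA : IsEGCM A) {w : Function.End (Fin n → ℝ)} (hw : w ∈ Wgrp A)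
    (h1 : w ≠ 1) : ∃ i, len A (w * S A i) + 1 = len A w := by
  obtain ⟨l, hl, rfl⟩ := exists_reduced_word hw
  rcases List.eq_nil_or_concat l with rfl | ⟨l', i, rfl⟩
  · exact absurd rfl h1
  rw [List.concat_eq_append] at *
  have hp : ((l' ++ [i]).map (S A)).prod * S A i = (l'.map (S A)).prod := by
    simp [mul_S_mul_S hA]
  refine ⟨i, le_antisymm ?_ ?_⟩
  · rw [hp, ← hl]
    simpa using len_prod_le (A := A) l'
  · have := len_mul_S_le (mul_mem hw (S_mem i)) i
    rwa [mul_S_mul_S hA] at this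

/-! ### Alternating products and rank-two computations -/

/-- The product of `k` alternating factors `⋯ S s * S t`, whose rightmost factor is `S t`. -/
noncomputable def altProd (A : Fin n → Fin n → ℝ) (s t : Fin n) : ℕ → Function.End (Fin n → ℝ)
  | 0 => 1
  | k + 1 => S A (if Even k then t else s) * altProd A s t k

lemma altProd_succ_left (s t : Fin n) (k : ℕ) :
    altProd A s t (k + 1) = S A (if Even k then t else s) * altProd A s t k := rfl

lemma altProd_succ_right (s t : Fin n) (k : ℕ) :
    altProd A s t (k + 1) = altProd A t s k * S A t := by
  induction k with
  | zero => simp [altProd]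
  | succ k ih =>
    rw [altProd_succ_left, ih, altProd_succ_left t s k, mul_assoc]
    by_cases h : Even k <;> simp [h, Nat.even_add_one]

lemma altProd_mem (s t : Fin n) (k : ℕ) : altProd A s t k ∈ Wgrp A := by
  induction k with
  | zero => exact one_mem _
  | succ k ih => exact mul_mem (S_mem _) ih

lemma len_mul_altProd_le {v : Function.End (Fin n → ℝ)} (hv : v ∈ Wgrp A) (s t : Fin n) (k : ℕ) :
    len A (v * altProd A s t k) ≤ len A v + k := by
  induction k generalizing s t with
  | zero => simp [altProd]
  | succ k ih =>
    rw [altProd_succ_right, ← mul_assoc]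
    have := len_mul_S_le (mul_mem hv (altProd_mem (A := A) t s k)) t
    have := ih t s
    omega

/-- Rescaled Chebyshev polynomials of the second kind: `chebU c k = sin (k θ) / sin θ` when
`c = 2 cos θ`. -/
def chebU (c : ℝ) : ℕ → ℝ
  | 0 => 0
  | 1 => 1
  | k + 2 => c * chebU c (k + 1) - chebU c k

lemma chebU_add_two (c : ℝ) (k : ℕ) : chebU c (k + 2) = c * chebU c (k + 1) - chebU c k := rfl

lemma chebU_pos_of_two_le {c : ℝ} (hc : 2 ≤ c) (k : ℕ) : 0 < chebU c (k + 1) := by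
  suffices h : 0 < chebU c (k + 1) ∧ chebU c k ≤ chebU c (k + 1) from h.1
  induction k with
  | zero => simp [chebU]
  | succ k ih =>
    rw [chebU_add_two]
    constructor <;> nlinarith [ih.1, ih.2]

lemma sin_mul_chebU (θ : ℝ) (k : ℕ) : sin θ * chebU (2 * cos θ) k = sin (k * θ) := by
  suffices h : sin θ * chebU (2 * cos θ) k = sin (k * θ) ∧
      sin θ * chebU (2 * cos θ) (k + 1) = sin ((k + 1 : ℕ) * θ) from h.1
  induction k with
  | zero => simp [chebU]
  | succ k ih =>
    refine ⟨ih.2, ?_⟩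
    have h1 : ((k + 1 + 1 : ℕ) : ℝ) * θ = (k + 1 : ℕ) * θ + θ := by push_cast; ring
    have h2 : (k : ℝ) * θ = (k + 1 : ℕ) * θ - θ := by push_cast; ring
    rw [h2, sin_sub] at ih
    rw [chebU_add_two, h1, sin_add]
    linear_combination (2 * cos θ) * ih.2 - ih.1

lemma sin_pi_div_pos {m : ℕ} (hm : 2 ≤ m) : 0 < sin (π / m) := by
  have : (2 : ℝ) ≤ m := by exact_mod_cast hm
  refine sin_pos_of_pos_of_lt_pi (by positivity) ?_
  rw [div_lt_iff₀ (by positivity)]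
  nlinarith [pi_pos]

lemma chebU_cos_pos {m k : ℕ} (hk : 0 < k) (hkm : k < m) :
    0 < chebU (2 * cos (π / m)) k := by
  have hs := sin_pi_div_pos (m := m) (by omega)
  refine pos_of_mul_pos_right ?_ hs.le
  rw [sin_mul_chebU]
  have hm0 : (0 : ℝ) < m := by exact_mod_cast hk.trans hkm
  have hk0 : (0 : ℝ) < k := by exact_mod_cast hk
  have hkm' : (k : ℝ) < m := by exact_mod_cast hkm
  refine sin_pos_of_pos_of_lt_pi (by positivity) ?_
  rw [mul_div_assoc', div_lt_iff₀ hm0]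
  nlinarith [pi_pos]

lemma chebU_cos_self {m : ℕ} (hm : 2 ≤ m) : chebU (2 * cos (π / m)) m = 0 := by
  have h := sin_mul_chebU (π / m) m
  rw [mul_div_cancel₀ _ (by positivity : (m : ℝ) ≠ 0), sin_pi] at h
  exact (mul_eq_zero.1 h).resolve_left (sin_pi_div_pos hm).ne'

lemma chebU_cos_pred {m : ℕ} (hm : 2 ≤ m) : chebU (2 * cos (π / m)) (m - 1) = 1 := by
  have h := sin_mul_chebU (π / m) (m - 1)
  rw [Nat.cast_sub (by omega), sub_mul, mul_div_cancel₀ _ (by positivity : (m : ℝ) ≠ 0),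
    Nat.cast_one, one_mul, sin_pi_sub] at h
  exact mul_left_cancel₀ (sin_pi_div_pos hm).ne' (h.trans (mul_one _).symm)

lemma altProd_simple (hA : IsEGCM A) {s t : Fin n} {c r : ℝ} (hr : r ≠ 0)
    (hts : A t s = -(r * c)) (hst : A s t = -(c / r)) (k : ℕ) :
    altProd A s t k (simple s) = if Even k
      then chebU c (k + 1) • simple s + (r * chebU c k) • simple t
      else chebU c k • simple s + (r * chebU c (k + 1)) • simple t := by
  induction k with
  | zero =>
    change simple s = _
    simp [chebU]
  | succ k ih =>
    rw [altProd_succ_left]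
    change S A _ (altProd A s t k (simple s)) = _
    rw [ih]
    by_cases h : Even k
    · simp only [h, if_true, Nat.even_add_one, not_true_eq_false, if_false, S_smul_add_smul,
        S_simple_self hA, S_simple, hts, chebU_add_two]
      module
    · simp only [h, if_false, Nat.even_add_one, not_false_eq_true, if_true, S_smul_add_smul,
        S_simple_self hA, S_simple, hst, chebU_add_two]
      match_scalars
      · field_simp
        ring
      · ring

/-- Parameters symmetrizing the off-diagonal pair `A s t`, `A t s`. -/
lemma exists_symmetrizing (hA : IsEGCM A) {s t : Fin n} (hst : s ≠ t) {c : ℝ} (hc : 0 ≤ c)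
    (h : A s t * A t s = c ^ 2) :
    ∃ r : ℝ, 0 < r ∧ A t s = -(r * c) ∧ A s t = -(c / r) ∧ (A s t = A t s → r = 1) := by
  have h1 := hA.2.1 s t hst
  have h2 := hA.2.1 t s hst.symm
  rcases hc.eq_or_lt with rfl | hc
  · have h0 : A s t = 0 ∧ A t s = 0 := by
      rcases mul_eq_zero.1 (h.trans (by norm_num)) with h0 | h0
      · exact ⟨h0, hA.2.2.1 _ _ h0⟩
      · exact ⟨hA.2.2.1 _ _ h0, h0⟩
    exact ⟨1, one_pos, by simp [h0.2], by simp [h0.1], fun _ => rfl⟩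
  · have hts : A t s < 0 := lt_of_le_of_ne h2 fun h0 => by
      rw [h0, mul_zero] at h
      exact (pow_pos hc 2).ne h
    refine ⟨-A t s / c, div_pos (neg_pos.2 hts) hc, by field_simp, ?_, fun heq => ?_⟩
    · have := hts.ne
      field_simp
      linear_combination h
    · rw [div_eq_one_iff_eq hc.ne']
      rw [heq] at h
      nlinarith

lemma mval_spec {s t : Fin n} (h : mval A s t ≠ 0) :
    2 ≤ mval A s t ∧ A s t * A t s = (2 * cos (π / mval A s t)) ^ 2 := by
  unfold mval at h ⊢
  split_ifs at h ⊢ with hk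
  · exact ⟨hk.choose_spec.1, hk.choose_spec.2.trans (by ring)⟩
  · exact absurd rfl h

lemma four_le_of_mval_eq_zero (hA : IsEGCM A) {s t : Fin n} (hst : s ≠ t) (h : mval A s t = 0) :
    4 ≤ A s t * A t s := by
  refine (hA.2.2.2 s t hst).resolve_right fun hk => ?_
  have h2 := hk.choose_spec.1
  rw [mval, dif_pos hk] at h
  omega

lemma cos_pi_div_nonneg {m : ℕ} (hm : 2 ≤ m) : 0 ≤ cos (π / m) := by
  have : (2 : ℝ) ≤ m := by exact_mod_cast hm
  have h0 : 0 ≤ π / m := by positivity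
  refine cos_nonneg_of_neg_pi_div_two_le_of_le (by linarith [pi_pos]) ?_
  gcongr

/-- The action of a short alternating product on the first simple root of a pair. -/
lemma exists_altProd_simple_eq (hA : IsEGCM A) {s t : Fin n} (hst : s ≠ t)
    (hodd : Odd (mval A s t) → A s t = A t s) {k : ℕ} (hk : 0 < k)
    (hkm : mval A s t ≠ 0 → k < mval A s t) :
    ∃ a b : ℝ, altProd A s t k (simple s) = a • simple s + b • simple t ∧
      (0 < a ∧ 0 < b ∨ a = 0 ∧ b = 1 ∨ a = 1 ∧ b = 0) := by
  obtain ⟨k, rfl⟩ : ∃ l, k = l + 1 := ⟨k - 1, by omega⟩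
  by_cases hm : mval A s t = 0
  · have h4 := four_le_of_mval_eq_zero hA hst hm
    obtain ⟨r, hr, h1, h2, -⟩ := exists_symmetrizing hA hst (sqrt_nonneg (A s t * A t s))
      (sq_sqrt (by linarith)).symm
    have hc : 2 ≤ √(A s t * A t s) := le_sqrt_of_sq_le (by linarith)
    have p1 := chebU_pos_of_two_le hc k
    have p2 := chebU_pos_of_two_le hc (k + 1)
    have h := altProd_simple hA hr.ne' h1 h2 (k + 1)
    split_ifs at h
    · exact ⟨_, _, h, .inl ⟨p2, mul_pos hr p1⟩⟩
    · exact ⟨_, _, h, .inl ⟨p1, mul_pos hr p2⟩⟩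
  · obtain ⟨h2m, hcos⟩ := mval_spec hm
    have hkm := hkm hm
    generalize mval A s t = m at *
    obtain ⟨r, hr, h1, h2, h3⟩ := exists_symmetrizing hA hst
      (mul_nonneg zero_le_two (cos_pi_div_nonneg h2m)) hcos
    have p1 := chebU_cos_pos k.succ_pos hkm
    have h := altProd_simple hA hr.ne' h1 h2 (k + 1)
    rcases (Nat.succ_le_of_lt hkm).lt_or_eq with hlt | heq
    · have p2 := chebU_cos_pos (k + 1).succ_pos hlt
      split_ifs at h
      · exact ⟨_, _, h, .inl ⟨p2, mul_pos hr p1⟩⟩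
      · exact ⟨_, _, h, .inl ⟨p1, mul_pos hr p2⟩⟩
    · have e0 : chebU (2 * cos (π / m)) (k + 1 + 1) = 0 := by
        have := chebU_cos_self h2m
        rwa [← heq] at this ⊢
      have e1 : chebU (2 * cos (π / m)) (k + 1) = 1 := by
        have := chebU_cos_pred h2m
        rwa [show m - 1 = k + 1 by omega] at this
      rw [e0, e1] at h
      split_ifs at h with hev
      · refine ⟨_, _, h, .inr (.inl ⟨rfl, ?_⟩)⟩
        rw [h3 (hodd (heq ▸ hev.add_one)), mul_one]
      · exact ⟨_, _, h, .inr (.inr ⟨rfl, mul_zero r⟩)⟩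

lemma altProd_simple_comm (hA : IsEGCM A) {s t : Fin n} {m : ℕ} (hm : 2 ≤ m) {r : ℝ}
    (hr : r ≠ 0) (hts : A t s = -(r * (2 * cos (π / m)))) (hst : A s t = -(2 * cos (π / m) / r)) :
    altProd A s t m (simple s) = altProd A t s m (simple s) := by
  obtain ⟨k, rfl⟩ : ∃ l, m = l + 1 := ⟨m - 1, by omega⟩
  have e0 := chebU_cos_self hm
  have e1 := chebU_cos_pred hm
  rw [Nat.add_sub_cancel] at e1
  have e2 := chebU_add_two (2 * cos (π / (k + 1 : ℕ))) k
  rw [e0, e1, mul_zero, zero_sub] at e2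
  rw [altProd_succ_right t s]
  change _ = altProd A s t k (S A s (simple s))
  rw [S_simple_self hA, map_neg_of_mem hA (altProd_mem s t k), altProd_simple hA hr hts hst,
    altProd_simple hA hr hts hst, e0, e1, e2]
  by_cases h : Even k <;> simp [h, Nat.even_add_one]

lemma altProd_apply_of_orthogonal {s t : Fin n} {v : Fin n → ℝ}
    (hs : ∑ j, A s j * v j = 0) (ht : ∑ j, A t j * v j = 0) (k : ℕ) :
    altProd A s t k v = v := by
  induction k with
  | zero => rfl
  | succ k ih =>
    rw [altProd_succ_left]
    change S A _ (altProd A s t k v) = v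
    rw [ih, S_apply]
    split_ifs <;> simp [hs, ht]

/-- The braid relation. -/
lemma altProd_comm (hA : IsEGCM A) {s t : Fin n} (hst : s ≠ t) (hm : mval A s t ≠ 0) :
    altProd A s t (mval A s t) = altProd A t s (mval A s t) := by
  obtain ⟨h2m, hcos⟩ := mval_spec hm
  generalize mval A s t = m at *
  have hc := mul_nonneg zero_le_two (cos_pi_div_nonneg h2m)
  obtain ⟨r, hr, h1, h2, -⟩ := exists_symmetrizing hA hst hc hcos
  obtain ⟨r', hr', h1', h2', -⟩ :=
    exists_symmetrizing hA hst.symm hc ((mul_comm _ _).trans hcos)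
  have es := altProd_simple_comm hA h2m hr.ne' h1 h2
  have et := altProd_simple_comm hA h2m hr'.ne' h1' h2'
  have hdet : 4 - A s t * A t s ≠ 0 := by
    rw [hcos]
    nlinarith [sin_pi_div_pos h2m, sin_sq_add_cos_sq (π / m)]
  funext v
  set p := ∑ j, A s j * v j with hp
  set q := ∑ j, A t j * v j with hq
  set a := (2 * p - A s t * q) / (4 - A s t * A t s) with ha
  set b := (2 * q - A t s * p) / (4 - A s t * A t s) with hb
  set u := v - a • simple s - b • simple t with hu
  have hsum : ∀ i, ∑ j, A i j * u j = ∑ j, A i j * v j - a * A i s - b * A i t := fun i => by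
    simp [hu, simple, mul_sub, Finset.sum_sub_distrib, Pi.single_apply, mul_comm]
  have hus : ∑ j, A s j * u j = 0 := by
    rw [hsum, hA.1 s, ← hp, ha, hb]
    field_simp
    ring
  have hut : ∑ j, A t j * u j = 0 := by
    rw [hsum, hA.1 t, ← hq, ha, hb]
    field_simp
    ring
  have hv : v = (1 : ℝ) • u + (1 : ℝ) • (a • simple s + b • simple t) := by
    rw [hu]
    module
  rw [hv, map_smul_add_smul hA (altProd_mem s t m), map_smul_add_smul hA (altProd_mem t s m),
    map_smul_add_smul hA (altProd_mem s t m), map_smul_add_smul hA (altProd_mem t s m),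
    altProd_apply_of_orthogonal hus hut, altProd_apply_of_orthogonal hut hus, es, et]

/-! ### Positivity of roots -/

lemma eq_smul_simple {v : Fin n → ℝ} {i : Fin n} (h : ∀ j ≠ i, v j = 0) : v = v i • simple i := by
  funext j
  by_cases hj : j = i
  · subst hj; simp [simple]
  · simp [simple, hj, h j hj]

/-- A positive combination of nonnegative independent vectors is never a multiple of a simple
root. -/
lemma smul_add_smul_ne_smul_simple (hA : IsEGCM A) {v : Function.End (Fin n → ℝ)}
    (hv : v ∈ Wgrp A) {s t : Fin n} (hst : s ≠ t) (hs : ∀ j, 0 ≤ v (simple s) j)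
    (ht : ∀ j, 0 ≤ v (simple t) j) {a b : ℝ} (ha : 0 < a) (hb : 0 < b) (c : ℝ) (i : Fin n) :
    a • v (simple s) + b • v (simple t) ≠ c • simple i := by
  intro h
  have hz : ∀ j ≠ i, v (simple s) j = 0 ∧ v (simple t) j = 0 := fun j hj => by
    have hj' := congrFun h j
    simp only [Pi.add_apply, Pi.smul_apply, smul_eq_mul, simple, Pi.single_apply, hj, if_false,
      mul_zero] at hj'
    have h1 := mul_nonneg ha.le (hs j)
    have h2 := mul_nonneg hb.le (ht j)
    exact ⟨(mul_eq_zero.1 (le_antisymm (by simp only [simple] at *; linarith) h1)).resolve_left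
        ha.ne',
      (mul_eq_zero.1 (le_antisymm (by simp only [simple] at *; linarith) h2)).resolve_left hb.ne'⟩
  have es := eq_smul_simple fun j hj => (hz j hj).1
  have et := eq_smul_simple fun j hj => (hz j hj).2
  have hzero : v (v (simple t) i • simple s + (-v (simple s) i) • simple t) = 0 := by
    rw [map_smul_add_smul hA hv]
    conv_lhs => rw [es, et]
    simp only [Pi.smul_apply, simple, Pi.single_eq_same, smul_eq_mul]
    module
  have h0 : v (simple s) i = 0 := by
    simpa [simple, hst.symm] using congrFun (eq_zero_of_map_eq_zero hA hv hzero) t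
  rw [h0, zero_smul] at es
  exact simple_ne_zero s (eq_zero_of_map_eq_zero hA hv es)

/-- If `w = v * altProd A s t k` is length-additive with `k` as large as possible, then `v` has
neither `s` nor `t` as a right descent, and `k` is less than `mval A s t` if that is finite. -/
lemma exists_parabolic_decomposition (hA : IsEGCM A) {w : Function.End (Fin n → ℝ)}
    (hw : w ∈ Wgrp A) {s : Fin n} (hs : len A w ≤ len A (w * S A s)) (h1 : w ≠ 1) :
    ∃ t, s ≠ t ∧ ∃ v ∈ Wgrp A, ∃ k, 0 < k ∧ (mval A s t ≠ 0 → k < mval A s t) ∧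
      w = v * altProd A s t k ∧ len A v < len A w ∧
      len A v ≤ len A (v * S A s) ∧ len A v ≤ len A (v * S A t) := by
  classical
  obtain ⟨t, ht⟩ := exists_right_descent hA hw h1
  have hst : s ≠ t := by rintro rfl; omega
  let D : ℕ → Prop := fun k => ∃ v ∈ Wgrp A, w = v * altProd A s t k ∧ len A v + k ≤ len A w
  have hex : ∃ k, ¬ D k := ⟨len A w + 1, by rintro ⟨v, -, -, h⟩; omega⟩
  have hD0 : D 0 := ⟨w, hw, by simp [altProd], by simp⟩
  have hD1 : D 1 := ⟨w * S A t, mul_mem hw (S_mem t), by simp [altProd, mul_S_mul_S hA], ht.le⟩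
  have hfind := Nat.find_spec hex
  have hmin : ∀ k < Nat.find hex, D k := fun k hk => not_not.1 (Nat.find_min hex hk)
  have hDm : mval A s t ≠ 0 → Nat.find hex ≤ mval A s t := fun hm => by
    refine Nat.find_min' hex ?_
    rintro ⟨v, hv, rfl, hlen⟩
    have hc := altProd_comm hA hst hm
    obtain ⟨m, hm'⟩ : ∃ l, mval A s t = l + 1 := ⟨mval A s t - 1, by omega⟩
    rw [hm'] at hs hlen hc
    have hle := len_mul_altProd_le hv s t m
    have e : v * altProd A s t (m + 1) * S A s = v * altProd A s t m := by
      rw [hc, altProd_succ_right, ← mul_assoc, mul_S_mul_S hA]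
    rw [e] at hs
    omega
  generalize Nat.find hex = K at *
  obtain ⟨k, rfl⟩ : ∃ k, K = k + 2 := by
    match K with
    | 0 => exact absurd hD0 hfind
    | 1 => exact absurd hD1 hfind
    | k + 2 => exact ⟨k, rfl⟩
  obtain ⟨v, hv, hwv, hlen⟩ := hmin (k + 1) (by omega)
  have hlast : len A v ≤ len A (v * S A (if Even k then t else s)) := by
    have e : w = v * S A (if Even k then t else s) * altProd A s t k := by
      rw [hwv, altProd_succ_left, mul_assoc]
    have := len_mul_altProd_le (mul_mem hv (S_mem (if Even k then t else s))) s t k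
    rw [← e] at this
    omega
  have hnext : len A v ≤ len A (v * S A (if Even (k + 1) then t else s)) := by
    by_contra! hlt
    refine hfind ⟨_, mul_mem hv (S_mem (if Even (k + 1) then t else s)), ?_, by omega⟩
    rw [altProd_succ_left, ← mul_assoc, mul_S_mul_S hA, hwv]
  refine ⟨t, hst, v, hv, k + 1, k.succ_pos, fun hm => hDm hm, hwv, by omega, ?_⟩
  by_cases h : Even k
  · simp only [h, if_true, Nat.even_add_one, not_true_eq_false, if_false] at hlast hnext
    exact ⟨hnext, hlast⟩
  · simp only [h, if_false, Nat.even_add_one, not_false_eq_true, if_true] at hlast hnext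
    exact ⟨hlast, hnext⟩

/-- If `s` is not a right descent of `w`, then `w` sends the simple root of `s` to a nonnegative
vector, which is a multiple of a simple root only if it equals that root. -/
theorem map_simple_nonneg (hA : IsEGCM A)
    (hnoodd : ∀ i j : Fin n, Odd (mval A i j) → A i j = A j i)
    {w : Function.End (Fin n → ℝ)} (hw : w ∈ Wgrp A) {s : Fin n}
    (hs : len A w ≤ len A (w * S A s)) :
    (∀ j, 0 ≤ w (simple s) j) ∧ ∀ (c : ℝ) (i : Fin n), w (simple s) = c • simple i → c = 1 := by
  induction hL : len A w using Nat.strong_induction_on generalizing w s with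
  | _ L ih =>
    subst hL
    by_cases h1 : w = 1
    · subst h1
      refine ⟨fun j => ?_, fun c i h => ?_⟩
      · change 0 ≤ (Pi.single s (1 : ℝ) : Fin n → ℝ) j
        by_cases h : j = s <;> simp [h]
      · have h := congrFun h s
        change (Pi.single s (1 : ℝ) : Fin n → ℝ) s = _ at h
        by_cases hi : s = i <;> simp [simple, hi] at h
        exact h.symm
    obtain ⟨t, hst, v, hv, k, hk, hkm, rfl, hlt, hvs, hvt⟩ :=
      exists_parabolic_decomposition hA hw hs h1
    obtain ⟨ps, cs⟩ := ih _ hlt hv hvs rfl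
    obtain ⟨pt, ct⟩ := ih _ hlt hv hvt rfl
    obtain ⟨a, b, hab, hcase⟩ := exists_altProd_simple_eq hA hst (hnoodd s t) hk hkm
    have e : (v * altProd A s t k) (simple s) = a • v (simple s) + b • v (simple t) := by
      change v (altProd A s t k (simple s)) = _
      rw [hab, map_smul_add_smul hA hv]
    rw [e]
    rcases hcase with ⟨ha, hb⟩ | ⟨rfl, rfl⟩ | ⟨rfl, rfl⟩
    · exact ⟨fun j => add_nonneg (mul_nonneg ha.le (ps j)) (mul_nonneg hb.le (pt j)),
        fun c i h => absurd h (smul_add_smul_ne_smul_simple hA hv hst ps pt ha hb c i)⟩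
    · simpa using ⟨pt, ct⟩
    · simpa using ⟨ps, cs⟩

lemma ne_zero_of_mem_Phi (hA : IsEGCM A) {β : Fin n → ℝ} (hβ : β ∈ Phi A) : β ≠ 0 := by
  obtain ⟨w, hw, i, rfl⟩ := hβ
  exact fun h => simple_ne_zero i (eq_zero_of_map_eq_zero hA hw h)

lemma map_mem_Phi {w : Function.End (Fin n → ℝ)} (hw : w ∈ Wgrp A) {β : Fin n → ℝ}
    (hβ : β ∈ Phi A) : w β ∈ Phi A := by
  obtain ⟨w', hw', i, rfl⟩ := hβ
  exact ⟨w * w', mul_mem hw hw', i, rfl⟩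

lemma simple_mem_PhiPos (i : Fin n) : simple i ∈ PhiPos A :=
  ⟨⟨1, one_mem _, i, rfl⟩, fun j => by by_cases h : j = i <;> simp [simple, h]⟩

lemma not_mem_PhiNeg_of_mem_PhiPos (hA : IsEGCM A) {β : Fin n → ℝ} (hβ : β ∈ PhiPos A) :
    β ∉ PhiNeg A := fun h =>
  ne_zero_of_mem_Phi hA hβ.1 (funext fun j => le_antisymm (h.2 j) (hβ.2 j))

/-- Every root is, up to sign, the image of a simple root under an element of which it is not a
right descent. -/
lemma exists_not_descent (hA : IsEGCM A) {β : Fin n → ℝ} (hβ : β ∈ Phi A) :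
    ∃ w ∈ Wgrp A, ∃ i, len A w ≤ len A (w * S A i) ∧
      (β = w (simple i) ∨ β = -w (simple i)) := by
  obtain ⟨w, hw, i, rfl⟩ := hβ
  rcases le_total (len A w) (len A (w * S A i)) with h | h
  · exact ⟨w, hw, i, h, .inl rfl⟩
  · refine ⟨w * S A i, mul_mem hw (S_mem i), i, by rwa [mul_S_mul_S hA], .inr ?_⟩
    change _ = -w (S A i (simple i))
    rw [S_simple_self hA, map_neg_of_mem hA hw, neg_neg]

lemma mem_PhiPos_or_mem_PhiNeg (hA : IsEGCM A)
    (hnoodd : ∀ i j : Fin n, Odd (mval A i j) → A i j = A j i) {β : Fin n → ℝ} (hβ : β ∈ Phi A) :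
    β ∈ PhiPos A ∨ β ∈ PhiNeg A := by
  obtain ⟨w, hw, i, hlen, rfl | rfl⟩ := exists_not_descent hA hβ
  · exact .inl ⟨hβ, (map_simple_nonneg hA hnoodd hw hlen).1⟩
  · exact .inr ⟨hβ, fun j => neg_nonpos.2 ((map_simple_nonneg hA hnoodd hw hlen).1 j)⟩

lemma eq_one_of_smul_simple_mem_PhiPos (hA : IsEGCM A)
    (hnoodd : ∀ i j : Fin n, Odd (mval A i j) → A i j = A j i) {c : ℝ} {i : Fin n}
    (h : c • simple i ∈ PhiPos A) : c = 1 := by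
  obtain ⟨w, hw, j, hlen, hc | hc⟩ := exists_not_descent hA h.1
  · exact (map_simple_nonneg hA hnoodd hw hlen).2 c i hc.symm
  · refine absurd ⟨h.1, fun l => ?_⟩ (not_mem_PhiNeg_of_mem_PhiPos hA h)
    rw [hc]
    exact neg_nonpos.2 ((map_simple_nonneg hA hnoodd hw hlen).1 l)

/-- The reflection `S A i` permutes the positive roots other than the simple root of `i`. -/
lemma S_mem_PhiPos (hA : IsEGCM A)
    (hnoodd : ∀ i j : Fin n, Odd (mval A i j) → A i j = A j i) {β : Fin n → ℝ} {i : Fin n}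
    (hβ : β ∈ PhiPos A) (hne : β ≠ simple i) : S A i β ∈ PhiPos A := by
  refine (mem_PhiPos_or_mem_PhiNeg hA hnoodd (map_mem_Phi (S_mem i) hβ.1)).resolve_right
    fun hneg => hne ?_
  have e : β = β i • simple i := eq_smul_simple fun j hj =>
    le_antisymm (S_apply_of_ne (A := A) hj β ▸ hneg.2 j) (hβ.2 j)
  have h1 : β i = 1 := eq_one_of_smul_simple_mem_PhiPos hA hnoodd (e ▸ hβ)
  rw [e, h1, one_smul]

/-- The inversion set grows by one root when a non-descent is appended. -/
lemma Nset_mul_S (hA : IsEGCM A)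
    (hnoodd : ∀ i j : Fin n, Odd (mval A i j) → A i j = A j i)
    {w : Function.End (Fin n → ℝ)} (hw : w ∈ Wgrp A) {i : Fin n}
    (hi : len A w ≤ len A (w * S A i)) :
    Nset A (w * S A i) = insert (simple i) (S A i '' Nset A w) := by
  have hpos : w (simple i) ∈ PhiPos A :=
    ⟨⟨w, hw, i, rfl⟩, (map_simple_nonneg hA hnoodd hw hi).1⟩
  ext β
  constructor
  · rintro ⟨hβ, hneg⟩
    by_cases hne : β = simple i
    · exact .inl hne
    · exact .inr ⟨S A i β, ⟨S_mem_PhiPos hA hnoodd hβ hne, hneg⟩, S_S_apply hA i β⟩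
  · rintro (rfl | ⟨γ, ⟨hγ, hneg⟩, rfl⟩)
    · refine ⟨simple_mem_PhiPos i, map_mem_Phi (mul_mem hw (S_mem i)) (simple_mem_PhiPos i).1, ?_⟩
      change ∀ j, w (S A i (simple i)) j ≤ 0
      rw [S_simple_self hA, map_neg_of_mem hA hw]
      exact fun j => neg_nonpos.2 (hpos.2 j)
    · refine ⟨S_mem_PhiPos hA hnoodd hγ ?_, ?_⟩
      · rintro rfl
        exact not_mem_PhiNeg_of_mem_PhiPos hA hpos hneg
      · change w (S A i (S A i γ)) ∈ PhiNeg A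
        rwa [S_S_apply hA]

lemma simple_notMem_image_Nset (hA : IsEGCM A) (w : Function.End (Fin n → ℝ)) (i : Fin n) :
    simple i ∉ S A i '' Nset A w := by
  rintro ⟨γ, ⟨hγ, -⟩, h⟩
  have e : γ = -simple i := by rw [← S_simple_self hA, ← h, S_S_apply hA]
  have := hγ.2 i
  simp [e, simple] at this
  linarith

end Reflections

/-- Corollary 3.10, second claim: if `(Γ, A)` has no odd asymmetries
(whenever `m_{ij}` is odd, `a_{ij} = a_{ji}`), then `|N(w)| = ℓ(w)` for all `w ∈ W`. -/
theorem stmt17 (A : Fin n → Fin n → ℝ) (hA : IsEGCM A)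
    (hnoodd : ∀ i j : Fin n, Odd (mval A i j) → A i j = A j i) :
    ∀ w ∈ Wgrp A, (Nset A w).Finite ∧ (Nset A w).ncard = len A w := by
  intro w hw
  induction hL : len A w generalizing w with
  | zero =>
    obtain ⟨l, hl, rfl⟩ := exists_reduced_word hw
    rw [hL, List.length_eq_zero_iff] at hl
    subst hl
    have hempty : Nset A ([].map (S A)).prod = ∅ :=
      Set.eq_empty_of_forall_notMem fun β hβ => not_mem_PhiNeg_of_mem_PhiPos hA hβ.1 hβ.2
    rw [hempty]
    exact ⟨Set.finite_empty, Set.ncard_empty _⟩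
  | succ L ih =>
    obtain ⟨i, hi⟩ := exists_right_descent hA hw (by rintro rfl; simp [len_one] at hL)
    have hwi := mul_mem hw (S_mem (A := A) i)
    obtain ⟨hfin, hcard⟩ := ih _ hwi (by omega)
    have hN := Nset_mul_S hA hnoodd hwi (i := i) (by rw [mul_S_mul_S hA]; omega)
    rw [mul_S_mul_S hA] at hN
    rw [hN]
    refine ⟨(hfin.image _).insert _, ?_⟩
    rw [Set.ncard_insert_of_notMem (simple_notMem_image_Nset hA _ i) (hfin.image _),
      Set.ncard_image_of_injective _ (Function.LeftInverse.injective (S_S_apply hA i)), hcard]
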